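/- Let x ∈ R_ap and suppose the ap-basic class [x]_ap is maximal for the order ≺. Then for every z ∈ Δ, x ⇝_ap z if and only if z ∈ [x]_ap. As a consequence, every ap-quasi-attractor is a closed set. -/

import Mathlib

open Metric Set Filter Topology
open scoped Classical ENNReal

noncomputable section

abbrev Euc (d : ℕ) := EuclideanSpace ℝ (Fin d)

/-- The standard simplex `Δ`. -/
def simplexSet (d : ℕ) : Set (Euc d) := {x | (∀ i, 0 ≤ x i) ∧ ∑ i, x i = 1}

/-- The relative interior `Δ̊`. -/
def simplexInt (d : ℕ) : Set (Euc d) := {x | (∀ i, 0 < x i) ∧ ∑ i, x i = 1}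

/-- The relative boundary `∂Δ`. -/
def simplexBd (d : ℕ) : Set (Euc d) := simplexSet d \ simplexInt d

/-- `Δ_N = Δ ∩ (1/N)ℤ^d`. -/
def deltaN (d N : ℕ) : Set (Euc d) := simplexSet d ∩ {x | ∀ i, ∃ z : ℤ, x i = (z : ℝ) / N}

/-- `Δ*_N = Δ̊ ∩ (1/N)ℤ^d`. -/
def deltaNstar (d N : ℕ) : Set (Euc d) := simplexInt d ∩ {x | ∀ i, ∃ z : ℤ, x i = (z : ℝ) / N}

/-- `F` is locally Lipschitz on `Δ` and its coordinates sum to zero. -/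
def IsMeanField (d : ℕ) (F : Euc d → Euc d) : Prop :=
  (∀ x ∈ simplexSet d, ∃ (K : NNReal) (ε : ℝ), 0 < ε ∧
      LipschitzOnWith K F (Metric.ball x ε ∩ simplexSet d)) ∧
  ∀ x ∈ simplexSet d, ∑ i, F x i = 0

/-- `φ` is the flow induced by the ODE `ẋ = F(x)`, leaving `Δ` and `∂Δ` invariant. -/
structure IsFlowOf (d : ℕ) (F : Euc d → Euc d) (φ : ℝ → Euc d → Euc d) : Prop where
  cont : Continuous fun p : ℝ × Euc d => φ p.1 p.2
  map_zero : ∀ x, φ 0 x = x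
  map_add : ∀ s t x, φ (s + t) x = φ s (φ t x)
  deriv : ∀ x ∈ simplexSet d, ∀ t : ℝ, HasDerivAt (fun s => φ s x) (F (φ t x)) t
  inv : ∀ t : ℝ, ∀ x ∈ simplexSet d, φ t x ∈ simplexSet d
  bdInv : ∀ t : ℝ, ∀ x ∈ simplexBd d, φ t x ∈ simplexBd d

/-- The data `(k, xs, ts)` is a `(δ,T)` absorption-preserving pseudo-orbit:
points `xs 0, …, xs (k+1)` of `Δ` and times `ts 1, …, ts k ≥ T`. -/
def IsAPOrbit (d : ℕ) (φ : ℝ → Euc d → Euc d) (δ T : ℝ) (k : ℕ)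
    (xs : ℕ → Euc d) (ts : ℕ → ℝ) : Prop :=
  1 ≤ k ∧ (∀ j ≤ k + 1, xs j ∈ simplexSet d) ∧ dist (xs 0) (xs 1) < δ ∧
  (∀ j, 1 ≤ j → j ≤ k → T ≤ ts j ∧ dist (φ (ts j) (xs j)) (xs (j + 1)) < δ) ∧
  (∀ j ≤ k, xs j ∈ simplexBd d → xs (j + 1) ∈ simplexBd d)

/-- `x ⇝_ap y`. -/
def leadsAp (d : ℕ) (φ : ℝ → Euc d → Euc d) (x y : Euc d) : Prop :=
  ∀ δ > (0 : ℝ), ∀ T > (0 : ℝ), ∃ k xs ts,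
    IsAPOrbit d φ δ T k xs ts ∧ xs 0 = x ∧ xs (k + 1) = y

/-- The set `R_ap` of ap-chain-recurrent points. -/
def Rap (d : ℕ) (φ : ℝ → Euc d → Euc d) : Set (Euc d) := {x | leadsAp d φ x x}

/-- The ap-basic class `[x]_ap`. -/
def apClass (d : ℕ) (φ : ℝ → Euc d → Euc d) (x : Euc d) : Set (Euc d) :=
  {y | leadsAp d φ x y ∧ leadsAp d φ y x}

/-- The class of `x` is maximal for the order `≺`, i.e. is an ap-quasi-attractor. -/
def IsAPQuasiAttractorAt (d : ℕ) (φ : ℝ → Euc d → Euc d) (x : Euc d) : Prop :=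
  x ∈ Rap d φ ∧ ∀ y ∈ Rap d φ, leadsAp d φ x y → leadsAp d φ y x

/-- The omega-limit set of `x` under the flow `φ`. -/
def omegaSet (d : ℕ) (φ : ℝ → Euc d → Euc d) (x : Euc d) : Set (Euc d) :=
  {y | ∃ u : ℕ → ℝ, Tendsto u atTop atTop ∧ Tendsto (fun n => φ (u n) x) atTop (nhds y)}

/-- `A` is an attractor for the flow `φ`: compact, invariant, attracting a
neighborhood uniformly. -/
def IsAttractor (d : ℕ) (φ : ℝ → Euc d → Euc d) (A : Set (Euc d)) : Prop :=
  IsCompact A ∧ (∀ t : ℝ, φ t '' A = A) ∧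
  ∃ U : Set (Euc d), IsOpen U ∧ A ⊆ U ∧
    ∀ ε > (0 : ℝ), ∃ T : ℝ, ∀ t ≥ T, ∀ x ∈ U, infDist (φ t x) A < ε


def APStep (d : ℕ) (φ : ℝ → Euc d → Euc d) (δ T : ℝ) (a b : Euc d) : Prop :=
  a ∈ simplexSet d ∧ b ∈ simplexSet d ∧ (∃ t, T ≤ t ∧ dist (φ t a) b < δ) ∧
    (a ∈ simplexBd d → b ∈ simplexBd d)

def APJump (d : ℕ) (δ : ℝ) (a b : Euc d) : Prop :=
  a ∈ simplexSet d ∧ b ∈ simplexSet d ∧ dist a b < δ ∧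
    (a ∈ simplexBd d → b ∈ simplexBd d)

theorem leadsAp_of_chain {d : ℕ} {φ : ℝ → Euc d → Euc d} {δ T : ℝ} {x x1 y : Euc d}
    (hj : APJump d δ x x1) (h : Relation.TransGen (APStep d φ δ T) x1 y) :
    ∃ k xs ts, IsAPOrbit d φ δ T k xs ts ∧ xs 0 = x ∧ xs (k + 1) = y := by
  obtain ⟨hx, hx1, hd, hb⟩ := hj
  induction h with
  | single hs =>
    rename_i b
    obtain ⟨_, hbS, ⟨t, htT, ht⟩, hbd⟩ := hs
    refine ⟨1, fun n => if n = 0 then x else if n = 1 then x1 else b, fun _ => t,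
      ⟨le_refl _, ?_, ?_, ?_, ?_⟩, ?_, ?_⟩
    · intro j _
      dsimp only
      split_ifs <;> assumption
    · simpa using hd
    · intro j h1 h2
      obtain rfl : j = 1 := by omega
      exact ⟨htT, by simpa using ht⟩
    · intro j h2
      obtain rfl | rfl : j = 0 ∨ j = 1 := by omega
      · simpa using hb
      · simpa using hbd
    · simp
    · simp
  | tail hprev hs ih =>
    rename_i b c
    obtain ⟨k, xs, ts, ⟨h1, h2, h3, h4, h5⟩, h0, hk⟩ := ih
    obtain ⟨_, hcS, ⟨t, htT, ht⟩, hbd⟩ := hs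
    refine ⟨k + 1, fun n => if n ≤ k + 1 then xs n else c, fun n => if n ≤ k then ts n else t,
      ⟨by omega, ?_, ?_, ?_, ?_⟩, ?_, ?_⟩
    · intro j _
      dsimp only
      split_ifs with hh
      · exact h2 j hh
      · exact hcS
    · simpa using h3
    · intro j hj1 hj2
      by_cases hjk : j ≤ k
      · have := h4 j hj1 hjk
        simpa [hjk, show j ≤ k + 1 by omega] using this
      · obtain rfl : j = k + 1 := by omega
        simpa [hk] using ⟨htT, ht⟩
    · intro j hj2
      by_cases hjk : j ≤ k
      · have := h5 j hjk
        simpa [hjk, show j ≤ k + 1 by omega] using this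
      · obtain rfl : j = k + 1 := by omega
        simpa [hk] using hbd
    · simpa using h0
    · simp

theorem leadsAp_chain {d : ℕ} {φ : ℝ → Euc d → Euc d} {x y : Euc d} (h : leadsAp d φ x y)
    {δ T : ℝ} (hδ : 0 < δ) (hT : 0 < T) :
    ∃ x1, APJump d δ x x1 ∧ Relation.TransGen (APStep d φ δ T) x1 y := by
  obtain ⟨k, xs, ts, ⟨h1, h2, h3, h4, h5⟩, rfl, rfl⟩ := h δ hδ T hT
  refine ⟨xs 1, ⟨h2 0 (by omega), h2 1 (by omega), h3, h5 0 (by omega)⟩, ?_⟩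
  have st : ∀ j, 1 ≤ j → j ≤ k → APStep d φ δ T (xs j) (xs (j + 1)) := fun j a b =>
    ⟨h2 j (by omega), h2 _ (by omega), ⟨ts j, h4 j a b⟩, h5 j b⟩
  have : ∀ j, 1 ≤ j → j ≤ k → Relation.TransGen (APStep d φ δ T) (xs 1) (xs (j + 1)) := by
    intro j hj
    induction j, hj using Nat.le_induction with
    | base => intro hk; exact .single (st 1 le_rfl hk)
    | succ n hn ih => intro hk; exact (ih (by omega)).tail (st (n + 1) (by omega) hk)
  exact this k h1 le_rfl

theorem APStep.mono {d : ℕ} {φ : ℝ → Euc d → Euc d} {δ δ' T : ℝ} (h : δ ≤ δ') {a b : Euc d}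
    (hs : APStep d φ δ T a b) : APStep d φ δ' T a b := by
  obtain ⟨h1, h2, ⟨t, h3, h4⟩, h5⟩ := hs
  exact ⟨h1, h2, ⟨t, h3, h4.trans_le h⟩, h5⟩

theorem APStep.jump {d : ℕ} {φ : ℝ → Euc d → Euc d} {δ T : ℝ} {a b c : Euc d}
    (hs : APStep d φ (δ / 2) T a b) (hj : APJump d (δ / 2) b c) : APStep d φ δ T a c := by
  obtain ⟨h1, h2, ⟨t, h3, h4⟩, h5⟩ := hs
  obtain ⟨g1, g2, g3, g4⟩ := hj
  exact ⟨h1, g2, ⟨t, h3, by linarith [dist_triangle (φ t a) b c]⟩, fun h => g4 (h5 h)⟩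

theorem transGen_jump {d : ℕ} {φ : ℝ → Euc d → Euc d} {δ T : ℝ} (hδ : 0 < δ) {a b c : Euc d}
    (hs : Relation.TransGen (APStep d φ (δ / 2) T) a b) (hj : APJump d (δ / 2) b c) :
    Relation.TransGen (APStep d φ δ T) a c := by
  obtain ⟨e, he, heb⟩ := Relation.TransGen.tail'_iff.1 hs
  exact Relation.TransGen.tail' (Relation.ReflTransGen.mono (fun _ _ h => APStep.mono (by linarith) h) _ _ he) (heb.jump hj)

theorem APJump.mono {d : ℕ} {δ δ' : ℝ} (h : δ ≤ δ') {a b : Euc d}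
    (hs : APJump d δ a b) : APJump d δ' a b :=
  ⟨hs.1, hs.2.1, hs.2.2.1.trans_le h, hs.2.2.2⟩

theorem leadsAp_trans {d : ℕ} {φ : ℝ → Euc d → Euc d} {x y z : Euc d}
    (h : leadsAp d φ x y) (h' : leadsAp d φ y z) : leadsAp d φ x z := by
  intro δ hδ T hT
  obtain ⟨x1, hj, hc⟩ := leadsAp_chain h (half_pos hδ) hT
  obtain ⟨y1, hj', hc'⟩ := leadsAp_chain h' (half_pos hδ) hT
  exact leadsAp_of_chain (hj.mono (by linarith))
    ((transGen_jump hδ hc hj').trans (Relation.TransGen.mono (fun _ _ h => APStep.mono (by linarith) h) _ _ hc'))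

theorem leadsAp_mem {d : ℕ} {φ : ℝ → Euc d → Euc d} {x y : Euc d}
    (h : leadsAp d φ x y) : y ∈ simplexSet d := by
  obtain ⟨k, xs, ts, ⟨h1, h2, _⟩, rfl, rfl⟩ := h 1 one_pos 1 one_pos
  exact h2 _ le_rfl

theorem simplex_closed (d : ℕ) : IsClosed (simplexSet d) := by
  have : simplexSet d = (⋂ i, {x : Euc d | 0 ≤ x i}) ∩ {x : Euc d | ∑ i, x i = 1} := by
    ext x; simp [simplexSet]
  rw [this]
  refine IsClosed.inter (isClosed_iInter fun i => isClosed_le (by fun_prop) (by fun_prop))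
    (isClosed_eq (by fun_prop) (by fun_prop))

theorem simplexBd_closed (d : ℕ) : IsClosed (simplexBd d) := by
  have : simplexBd d = simplexSet d ∩ ⋃ i, {x : Euc d | x i ≤ 0} := by
    ext x
    simp only [simplexBd, simplexSet, simplexInt, Set.mem_sdiff, mem_ofPred_eq, mem_inter_iff, mem_iUnion]
    constructor
    · rintro ⟨h, h'⟩
      refine ⟨h, ?_⟩
      by_contra! hc
      exact h' ⟨hc, h.2⟩
    · rintro ⟨h, i, hi⟩
      exact ⟨h, fun h' => absurd (h'.1 i) (not_lt.2 hi)⟩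
  rw [this]
  exact (simplex_closed d).inter
    (isClosed_iUnion_of_finite fun i => isClosed_le (by fun_prop) (by fun_prop))

theorem simplex_compact (d : ℕ) : IsCompact (simplexSet d) := by
  refine Metric.isCompact_of_isClosed_isBounded (simplex_closed d) ?_
  refine (Metric.isBounded_closedBall (x := (0 : Euc d)) (r := 1)).subset ?_
  intro x hx
  rw [mem_closedBall_zero_iff, EuclideanSpace.norm_eq, Real.sqrt_le_iff]
  refine ⟨zero_le_one, ?_⟩
  rw [one_pow, ← hx.2]
  refine Finset.sum_le_sum fun i _ => ?_
  have h0 := hx.1 i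
  have h1 : x i ≤ 1 := by
    rw [← hx.2]
    exact Finset.single_le_sum (f := fun i => x i) (fun j _ => hx.1 j) (Finset.mem_univ i)
  rw [Real.norm_eq_abs, sq_abs]
  nlinarith

section
variable {d : ℕ} {F : Euc d → Euc d} {φ : ℝ → Euc d → Euc d}

theorem omega_exists (hφ : IsFlowOf d F φ) {z : Euc d} (hz : z ∈ simplexSet d) :
    ∃ y ∈ simplexSet d, y ∈ omegaSet d φ z := by
  obtain ⟨y, hy, f, hf, hl⟩ := (simplex_compact d).tendsto_subseq
    (x := fun n : ℕ => φ n z) (fun n => hφ.inv n z hz)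
  exact ⟨y, hy, fun n => (f n : ℝ), tendsto_natCast_atTop_atTop.comp hf.tendsto_atTop, hl⟩

theorem omega_bd (hφ : IsFlowOf d F φ) {z y : Euc d} (hz : z ∈ simplexBd d)
    (hy : y ∈ omegaSet d φ z) : y ∈ simplexBd d := by
  obtain ⟨u, _, hu⟩ := hy
  exact (simplexBd_closed d).mem_of_tendsto hu (Eventually.of_forall fun n => hφ.bdInv _ _ hz)

theorem omega_leads (hφ : IsFlowOf d F φ) {z y : Euc d} (hz : z ∈ simplexSet d)
    (hyS : y ∈ simplexSet d) (hy : y ∈ omegaSet d φ z) : leadsAp d φ z y := by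
  intro δ hδ T hT
  have hb : z ∈ simplexBd d → y ∈ simplexBd d := fun h => omega_bd hφ h hy
  obtain ⟨u, hu, hl⟩ := hy
  obtain ⟨n, h1, h2⟩ := ((hu.eventually_ge_atTop T).and (Metric.tendsto_nhds.1 hl δ hδ)).exists
  exact leadsAp_of_chain (x1 := z) ⟨hz, hz, by simpa using hδ, id⟩
    (.single ⟨hz, hyS, ⟨u n, h1, h2⟩, hb⟩)

theorem omega_rec (hφ : IsFlowOf d F φ) {z y : Euc d} (hz : z ∈ simplexSet d)
    (hyS : y ∈ simplexSet d) (hy : y ∈ omegaSet d φ z)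
    (hzy : y ∈ simplexBd d → z ∈ simplexBd d) : leadsAp d φ y y := by
  intro δ hδ T hT
  have hb : z ∈ simplexBd d → y ∈ simplexBd d := fun h => omega_bd hφ h hy
  obtain ⟨u, hu, hl⟩ := hy
  have hl' := Metric.tendsto_nhds.1 hl δ hδ
  obtain ⟨n, h2⟩ := hl'.exists
  obtain ⟨m, h3, h4⟩ := ((hu.eventually_ge_atTop (T + u n)).and hl').exists
  refine leadsAp_of_chain (x1 := φ (u n) z)
    ⟨hyS, hφ.inv _ _ hz, by rwa [dist_comm], fun h => hφ.bdInv _ _ (hzy h)⟩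
    (.single ⟨hφ.inv _ _ hz, hyS, ⟨u m - u n, by linarith, ?_⟩, fun h => hb ?_⟩)
  · rwa [← hφ.map_add, sub_add_cancel]
  · have := hφ.bdInv (-u n) _ h
    rwa [← hφ.map_add, neg_add_cancel, hφ.map_zero] at this

theorem leads_rec (hφ : IsFlowOf d F φ) {z : Euc d} (hz : z ∈ simplexSet d) :
    ∃ y, leadsAp d φ z y ∧ leadsAp d φ y y := by
  obtain ⟨y, hyS, hy⟩ := omega_exists hφ hz
  by_cases hb : y ∈ simplexBd d
  · obtain ⟨w, hwS, hw⟩ := omega_exists hφ hyS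
    exact ⟨w, leadsAp_trans (omega_leads hφ hz hyS hy) (omega_leads hφ hyS hwS hw),
      omega_rec hφ hyS hwS hw fun _ => hb⟩
  · exact ⟨y, omega_leads hφ hz hyS hy, omega_rec hφ hz hyS hy fun h => absurd h hb⟩

theorem leads_closed (x : Euc d) : IsClosed {z | leadsAp d φ x z} := by
  rw [← isSeqClosed_iff_isClosed]
  intro u z hu hl
  have hzS : z ∈ simplexSet d := (simplex_closed d).mem_of_tendsto hl
    (Eventually.of_forall fun n => leadsAp_mem (hu n))
  intro δ hδ T hT
  have hb : ∀ᶠ n in atTop, (u n ∈ simplexBd d → z ∈ simplexBd d) := by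
    by_cases h : z ∈ simplexBd d
    · exact Eventually.of_forall fun _ _ => h
    · filter_upwards [hl.eventually ((simplexBd_closed d).isOpen_compl.mem_nhds h)] with n hn h'
      exact absurd h' hn
  obtain ⟨n, h1, h2⟩ := (hb.and (Metric.tendsto_nhds.1 hl (δ / 2) (half_pos hδ))).exists
  obtain ⟨x1, hj, hc⟩ := leadsAp_chain (hu n) (half_pos hδ) hT
  exact leadsAp_of_chain (hj.mono (by linarith))
    (transGen_jump hδ hc ⟨leadsAp_mem (hu n), hzS, h2, h1⟩)

end

/-- if `[x]_ap` is maximal then `x ⇝_ap z ↔ z ∈ [x]_ap`, and every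
ap-quasi-attractor is closed. -/
theorem stmt7 {d : ℕ} (F : Euc d → Euc d) (hF : IsMeanField d F)
    (φ : ℝ → Euc d → Euc d) (hφ : IsFlowOf d F φ)
    (x : Euc d) (hx : x ∈ Rap d φ)
    (hmax : ∀ y ∈ Rap d φ, leadsAp d φ x y → leadsAp d φ y x) :
    (∀ z ∈ simplexSet d, (leadsAp d φ x z ↔ z ∈ apClass d φ x)) ∧
    IsClosed (apClass d φ x) := by
  have key : ∀ z, leadsAp d φ x z ↔ z ∈ apClass d φ x := by
    intro z
    refine ⟨fun h => ⟨h, ?_⟩, fun h => h.1⟩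
    obtain ⟨y, hzy, hyy⟩ := leads_rec hφ (leadsAp_mem h)
    exact leadsAp_trans hzy (hmax y hyy (leadsAp_trans h hzy))
  refine ⟨fun z _ => key z, ?_⟩
  have : apClass d φ x = {z | leadsAp d φ x z} := by
    ext z; exact (key z).symm
  rw [this]
  exact leads_closed x

end
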